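/- Let μ and μ' be two quasi-stationary Markov measures on K_N, associated to (λ, T) and (λ', T') respectively. Then μ and μ' are equivalent (mutually absolutely continuous) if and only if for μ-almost every and μ'-almost every i₁i₂… ∈ K_N, Σ_{n=1}^∞ (1 − Σ_{x∈Z_N} √(T'^(n)_{i_n,x}) √(T^(n)_{i_n,x})) < ∞. -/

import Mathlib

open MeasureTheory Filter Finset

/-- `IsMarkov μ l T` means that `μ` is the Markov measure on `K_N = ℕ → Fin N`
associated to the probability vector `l` and the sequence of transition matrices `T`
(with `T n` playing the role of `T^(n+1)` of the paper, and words indexed from `0`):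
for every cylinder set determined by the first `n + 1` letters,
`μ(C(w₀ … w_n)) = l_{w₀} T^(1)_{w₀,w₁} ⋯ T^(n)_{w_{n-1},w_n}`. -/
def IsMarkov {N : ℕ} (μ : Measure (ℕ → Fin N)) (l : Fin N → ℝ)
    (T : ℕ → Matrix (Fin N) (Fin N) ℝ) : Prop :=
  ∀ (n : ℕ) (w : ℕ → Fin N),
    μ {x | ∀ k ≤ n, x k = w k} =
      ENNReal.ofReal (l (w 0) * ∏ k ∈ Finset.range n, T k (w k) (w (k + 1)))

open Topology

section PathWeight

variable {ι : Type*}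

/-- The weight of a word of length `n + 1` under an initial vector and transition matrices. -/
def pathWeight (l : ι → ℝ) (T : ℕ → Matrix ι ι ℝ) (n : ℕ) (w : Fin (n + 1) → ι) : ℝ :=
  l (w 0) * ∏ k : Fin n, T k (w k.castSucc) (w k.succ)

theorem pathWeight_snoc (l : ι → ℝ) (T : ℕ → Matrix ι ι ℝ) (n : ℕ) (w : Fin (n + 1) → ι) (j : ι) :
    pathWeight l T (n + 1) (Fin.snoc (α := fun _ => ι) w j) =
      pathWeight l T n w * T n (w (Fin.last n)) j := by
  have h0 : (Fin.snoc (α := fun _ => ι) w j : Fin (n + 2) → ι) 0 = w 0 := by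
    rw [← Fin.castSucc_zero, Fin.snoc_castSucc]
  simp only [pathWeight, Fin.prod_univ_castSucc, h0, ← Fin.castSucc_succ, Fin.snoc_castSucc,
    Fin.succ_last, Fin.snoc_last, Fin.val_castSucc, Fin.val_last, mul_assoc]

theorem pathWeight_nonneg {l : ι → ℝ} {T : ℕ → Matrix ι ι ℝ} (hl : ∀ i, 0 ≤ l i)
    (hT : ∀ n i j, 0 ≤ T n i j) (n : ℕ) (w : Fin (n + 1) → ι) : 0 ≤ pathWeight l T n w :=
  mul_nonneg (hl _) (Finset.prod_nonneg fun _ _ => hT _ _ _)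

theorem pathWeight_pos {l : ι → ℝ} {T : ℕ → Matrix ι ι ℝ} (hl : ∀ i, 0 < l i)
    (hT : ∀ n i j, 0 < T n i j) (n : ℕ) (w : Fin (n + 1) → ι) : 0 < pathWeight l T n w :=
  mul_pos (hl _) (Finset.prod_pos fun _ _ => hT _ _ _)

theorem pathWeight_sqrt_mul_sqrt {l l' : ι → ℝ} {T T' : ℕ → Matrix ι ι ℝ} (hl : ∀ i, 0 ≤ l i)
    (hT : ∀ n i j, 0 ≤ T n i j) (hl' : ∀ i, 0 ≤ l' i) (hT' : ∀ n i j, 0 ≤ T' n i j) (n : ℕ)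
    (w : Fin (n + 1) → ι) :
    pathWeight (fun i => √(l' i) * √(l i)) (fun n i j => √(T' n i j) * √(T n i j)) n w =
      √(pathWeight l' T' n w) * √(pathWeight l T n w) := by
  have sqrt_weight {l : ι → ℝ} {T : ℕ → Matrix ι ι ℝ} (hl : ∀ i, 0 ≤ l i)
      (hT : ∀ n i j, 0 ≤ T n i j) :
      √(pathWeight l T n w) =
        √(l (w 0)) * ∏ k : Fin n, √(T k (w k.castSucc) (w k.succ)) := by
    rw [pathWeight, Real.sqrt_mul (hl _), Real.sqrt_prod _ fun _ _ => hT _ _ _]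
  rw [sqrt_weight hl hT, sqrt_weight hl' hT']
  simp only [pathWeight, Finset.prod_mul_distrib]
  ring

theorem pathWeight_sq_div (l l' : ι → ℝ) (T T' : ℕ → Matrix ι ι ℝ) (n : ℕ) (w : Fin (n + 1) → ι) :
    pathWeight (fun i => l i ^ 2 / l' i) (fun n i j => T n i j ^ 2 / T' n i j) n w =
      pathWeight l T n w ^ 2 / pathWeight l' T' n w := by
  simp only [pathWeight, Finset.prod_div_distrib, Finset.prod_pow]
  rw [mul_pow, div_mul_div_comm]

variable [Fintype ι]

/-- The sum over all words of length `n + 1` of their weight times a function of the last letter. -/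
def pathSum (l : ι → ℝ) (T : ℕ → Matrix ι ι ℝ) (n : ℕ) (f : ι → ℝ) : ℝ :=
  ∑ w : Fin (n + 1) → ι, pathWeight l T n w * f (w (Fin.last n))

theorem pathSum_zero (l : ι → ℝ) (T : ℕ → Matrix ι ι ℝ) (f : ι → ℝ) :
    pathSum l T 0 f = ∑ i, l i * f i := by
  rw [pathSum, ← (Equiv.funUnique (Fin 1) ι).symm.sum_comp]
  simp [pathWeight, Equiv.funUnique]

theorem pathSum_succ (l : ι → ℝ) (T : ℕ → Matrix ι ι ℝ) (n : ℕ) (f : ι → ℝ) :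
    pathSum l T (n + 1) f = pathSum l T n fun i => ∑ j, T n i j * f j := by
  simp only [pathSum]
  rw [← (Fin.snocEquiv fun _ => ι).sum_comp, Fintype.sum_prod_type_right]
  refine Finset.sum_congr rfl fun w _ => ?_
  rw [Finset.mul_sum]
  refine Finset.sum_congr rfl fun j _ => ?_
  change pathWeight l T (n + 1) (Fin.snoc (α := fun _ => ι) w j) *
    f (Fin.snoc (α := fun _ => ι) w j (Fin.last (n + 1))) = _
  rw [pathWeight_snoc, Fin.snoc_last, mul_assoc]

theorem pathSum_const_mul (l : ι → ℝ) (T : ℕ → Matrix ι ι ℝ) (n : ℕ) (a : ℝ) (f : ι → ℝ) :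
    pathSum l T n (fun i => a * f i) = a * pathSum l T n f := by
  simp only [pathSum, Finset.mul_sum]
  exact Finset.sum_congr rfl fun _ _ => by ring

theorem pathSum_sub (l : ι → ℝ) (T : ℕ → Matrix ι ι ℝ) (n : ℕ) (f g : ι → ℝ) :
    pathSum l T n (fun i => f i - g i) = pathSum l T n f - pathSum l T n g := by
  simp only [pathSum, mul_sub, Finset.sum_sub_distrib]

theorem pathSum_mono {l : ι → ℝ} {T : ℕ → Matrix ι ι ℝ} (hl : ∀ i, 0 ≤ l i)
    (hT : ∀ n i j, 0 ≤ T n i j) (n : ℕ) {f g : ι → ℝ} (hfg : ∀ i, f i ≤ g i) :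
    pathSum l T n f ≤ pathSum l T n g :=
  Finset.sum_le_sum fun _ _ => mul_le_mul_of_nonneg_left (hfg _) (pathWeight_nonneg hl hT n _)

theorem pathSum_nonneg {l : ι → ℝ} {T : ℕ → Matrix ι ι ℝ} (hl : ∀ i, 0 ≤ l i)
    (hT : ∀ n i j, 0 ≤ T n i j) (n : ℕ) {f : ι → ℝ} (hf : ∀ i, 0 ≤ f i) :
    0 ≤ pathSum l T n f :=
  Finset.sum_nonneg fun _ _ => mul_nonneg (pathWeight_nonneg hl hT n _) (hf _)

theorem pathSum_one_of_stochastic {l : ι → ℝ} {T : ℕ → Matrix ι ι ℝ} (hl : ∑ i, l i = 1)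
    (hT : ∀ n i, ∑ j, T n i j = 1) (n : ℕ) : pathSum l T n (fun _ => 1) = 1 := by
  induction n with
  | zero => simpa [pathSum_zero] using hl
  | succ n ih => simpa [pathSum_succ, hT] using ih

/-- If all transition weights are at least `c`, the last letter is distributed over the whole
alphabet with weights at least `c`. -/
theorem mul_pathSum_le_pathSum_succ {l : ι → ℝ} {T : ℕ → Matrix ι ι ℝ} {c : ℝ}
    (hl : ∀ i, 0 ≤ l i) (hc : 0 ≤ c) (hT : ∀ n i j, c ≤ T n i j) (n : ℕ) {f : ι → ℝ}
    (hf : ∀ i, 0 ≤ f i) :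
    (c * ∑ j, f j) * pathSum l T n (fun _ => 1) ≤ pathSum l T (n + 1) f := by
  rw [pathSum_succ, ← pathSum_const_mul]
  refine pathSum_mono hl (fun n i j => hc.trans (hT n i j)) n fun i => ?_
  rw [mul_one, Finset.mul_sum]
  exact Finset.sum_le_sum fun j _ => mul_le_mul_of_nonneg_right (hT n i j) (hf j)

/-- A divergent total row defect forces the total mass of substochastic transition matrices with
entries bounded below to vanish. -/
theorem tendsto_pathSum_zero {l : ι → ℝ} {R : ℕ → Matrix ι ι ℝ} {h : ℕ → ι → ℝ} {c : ℝ}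
    (hl : ∀ i, 0 ≤ l i) (hc : 0 < c) (hR : ∀ n i j, c ≤ R n i j)
    (hrow : ∀ n i, ∑ j, R n i j = 1 - h n i) (hh : ∀ n i, 0 ≤ h n i)
    (hdiv : ¬ Summable fun n => ∑ i, h n i) :
    Tendsto (fun n => pathSum l R n (fun _ => 1)) atTop (𝓝 0) := by
  have hR0 : ∀ n i j, 0 ≤ R n i j := fun n i j => hc.le.trans (hR n i j)
  have hV0 : ∀ n, 0 ≤ pathSum l R n (fun _ => 1) :=
    fun n => pathSum_nonneg hl hR0 n fun _ => zero_le_one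
  have hstep : ∀ n, pathSum l R (n + 1) (fun _ => 1) =
      pathSum l R n (fun _ => 1) - pathSum l R n (h n) := fun n => by
    rw [pathSum_succ, ← pathSum_sub]
    simp [hrow]
  have hanti : ∀ n, pathSum l R (n + 1) (fun _ => 1) ≤ pathSum l R n (fun _ => 1) := fun n => by
    rw [hstep]
    exact sub_le_self _ (pathSum_nonneg hl hR0 n (hh n))
  have hH0 : ∀ n, 0 ≤ ∑ i, h (n + 1) i := fun n => Finset.sum_nonneg fun i _ => hh _ i
  have hbound : ∀ n, pathSum l R (n + 1) (fun _ => 1) ≤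
      pathSum l R 1 (fun _ => 1) * Real.exp (-(c * ∑ k ∈ range n, ∑ i, h (k + 1) i)) := by
    intro n
    induction n with
    | zero => simp
    | succ n ih =>
      have h1 := mul_pathSum_le_pathSum_succ hl hc.le hR n (hh (n + 1))
      have h2 : (c * ∑ i, h (n + 1) i) * pathSum l R (n + 1) (fun _ => 1) ≤
          (c * ∑ i, h (n + 1) i) * pathSum l R n (fun _ => 1) :=
        mul_le_mul_of_nonneg_left (hanti n) (mul_nonneg hc.le (hH0 n))
      have h3 : pathSum l R (n + 2) (fun _ => 1) ≤
          pathSum l R (n + 1) (fun _ => 1) * (-(c * ∑ i, h (n + 1) i) + 1) := by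
        rw [hstep (n + 1)]
        linarith
      calc pathSum l R (n + 2) (fun _ => 1)
          ≤ pathSum l R (n + 1) (fun _ => 1) * Real.exp (-(c * ∑ i, h (n + 1) i)) :=
            h3.trans (mul_le_mul_of_nonneg_left (Real.add_one_le_exp _) (hV0 _))
        _ ≤ _ := mul_le_mul_of_nonneg_right ih (Real.exp_pos _).le
        _ = _ := by
            rw [mul_assoc, ← Real.exp_add, sum_range_succ]
            ring_nf
  rw [← summable_nat_add_iff 1, not_summable_iff_tendsto_nat_atTop_of_nonneg hH0] at hdiv
  rw [← tendsto_add_atTop_iff_nat 1]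
  refine squeeze_zero (fun n => hV0 (n + 1)) hbound ?_
  simpa using (Real.tendsto_exp_neg_atTop_nhds_zero.comp
    (hdiv.const_mul_atTop hc)).const_mul (pathSum l R 1 fun _ => 1)

/-- The total mass stays bounded when the row sums exceed `1` by a summable amount. -/
theorem pathSum_le_exp {l : ι → ℝ} {R : ℕ → Matrix ι ι ℝ} {H : ℕ → ℝ}
    (hl : ∀ i, 0 ≤ l i) (hR : ∀ n i j, 0 ≤ R n i j) (hrow : ∀ n i, ∑ j, R n i j ≤ 1 + H n)
    (hH : ∀ n, 0 ≤ H n) (hsum : Summable H) (n : ℕ) :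
    pathSum l R n (fun _ => 1) ≤ (∑ i, l i) * Real.exp (∑' n, H n) := by
  have hprod : pathSum l R n (fun _ => 1) ≤ (∑ i, l i) * ∏ k ∈ range n, (1 + H k) := by
    induction n with
    | zero => simp [pathSum_zero]
    | succ n ih =>
      rw [pathSum_succ, prod_range_succ, ← mul_assoc]
      calc pathSum l R n (fun i => ∑ j, R n i j * 1)
          ≤ pathSum l R n (fun _ => (1 + H n) * 1) :=
            pathSum_mono hl hR n fun i => by simpa using hrow n i
        _ = (1 + H n) * pathSum l R n (fun _ => 1) := pathSum_const_mul ..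
        _ ≤ _ := by
            rw [mul_comm]
            exact mul_le_mul_of_nonneg_right ih (by linarith [hH n])
  refine hprod.trans (mul_le_mul_of_nonneg_left ?_ (Finset.sum_nonneg fun i _ => hl i))
  exact (Real.prod_one_add_le_exp_sum _ hH).trans
    (Real.exp_le_exp.2 (hsum.sum_le_tsum _ fun k _ => hH k))

end PathWeight

section Hellinger

variable {ι : Type*} [Fintype ι]

theorem hellinger_eq {p q : ι → ℝ} (hp : ∀ i, 0 ≤ p i) (hq : ∀ i, 0 ≤ q i)
    (hp1 : ∑ i, p i = 1) (hq1 : ∑ i, q i = 1) :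
    1 - ∑ i, √(q i) * √(p i) = (∑ i, (√(p i) - √(q i)) ^ 2) / 2 := by
  have : ∑ i, (√(p i) - √(q i)) ^ 2 = ∑ i, (p i + q i - 2 * (√(q i) * √(p i))) :=
    Finset.sum_congr rfl fun i _ => by
      rw [sub_sq, Real.sq_sqrt (hp i), Real.sq_sqrt (hq i)]
      ring
  rw [this, Finset.sum_sub_distrib, Finset.sum_add_distrib, hp1, hq1, ← Finset.mul_sum]
  ring

theorem hellinger_nonneg {p q : ι → ℝ} (hp : ∀ i, 0 ≤ p i) (hq : ∀ i, 0 ≤ q i)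
    (hp1 : ∑ i, p i = 1) (hq1 : ∑ i, q i = 1) : 0 ≤ 1 - ∑ i, √(q i) * √(p i) := by
  rw [hellinger_eq hp hq hp1 hq1]
  exact div_nonneg (Finset.sum_nonneg fun _ _ => sq_nonneg _) zero_le_two

/-- The χ²-divergence is controlled by the Hellinger distance when the second distribution is
bounded below. -/
theorem sum_sq_div_le {p q : ι → ℝ} {c : ℝ} (hc : 0 < c) (hp : ∀ i, 0 ≤ p i)
    (hq : ∀ i, c ≤ q i) (hp1 : ∑ i, p i = 1) (hq1 : ∑ i, q i = 1) :
    ∑ i, p i ^ 2 / q i ≤ 1 + 8 / c * (1 - ∑ i, √(q i) * √(p i)) := by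
  have hq0 : ∀ i, 0 < q i := fun i => hc.trans_le (hq i)
  have hple : ∀ i, √(p i) ≤ 1 := fun i => Real.sqrt_le_one.2 <|
    hp1 ▸ Finset.single_le_sum (fun j _ => hp j) (Finset.mem_univ i)
  have hqle : ∀ i, √(q i) ≤ 1 := fun i => Real.sqrt_le_one.2 <|
    hq1 ▸ Finset.single_le_sum (fun j _ => (hq0 j).le) (Finset.mem_univ i)
  have hterm : ∀ i, p i ^ 2 / q i ≤ 2 * p i - q i + 4 / c * (√(p i) - √(q i)) ^ 2 := by
    intro i
    have h1 : p i ^ 2 / q i = 2 * p i - q i + (p i - q i) ^ 2 / q i := by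
      field_simp [(hq0 i).ne']
      ring
    have h2 : (p i - q i) ^ 2 ≤ 4 * (√(p i) - √(q i)) ^ 2 := by
      have h3 : p i - q i = (√(p i) - √(q i)) * (√(p i) + √(q i)) := by
        nlinarith [Real.sq_sqrt (hp i), Real.sq_sqrt (hq0 i).le]
      have h4 : (√(p i) + √(q i)) ^ 2 ≤ 4 := by
        nlinarith [hple i, hqle i, Real.sqrt_nonneg (p i), Real.sqrt_nonneg (q i)]
      rw [h3, mul_pow, mul_comm]
      exact mul_le_mul_of_nonneg_right h4 (sq_nonneg _)
    rw [h1, div_mul_eq_mul_div]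
    gcongr
    exact hq i
  calc ∑ i, p i ^ 2 / q i
      ≤ ∑ i, (2 * p i - q i + 4 / c * (√(p i) - √(q i)) ^ 2) :=
        Finset.sum_le_sum fun i _ => hterm i
    _ = _ := by
        rw [hellinger_eq hp (fun i => (hq0 i).le) hp1 hq1, Finset.sum_add_distrib,
          Finset.sum_sub_distrib, ← Finset.mul_sum, ← Finset.mul_sum, hp1, hq1]
        ring

end Hellinger

section QuasiStationary

/-- A positive sequence whose consecutive ratios are summably close to `1` is bounded below. -/
theorem exists_pos_le_of_summable_ratio {a : ℕ → ℝ} (ha : ∀ n, 0 < a n)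
    (hs : Summable fun n => |a n / a (n + 1) - 1|) : ∃ c > 0, ∀ n, c ≤ a n := by
  refine ⟨a 0 / Real.exp (∑' n, |a n / a (n + 1) - 1|), div_pos (ha 0) (Real.exp_pos _),
    fun n => ?_⟩
  have hprod : a 0 ≤ a n * ∏ k ∈ range n, (1 + |a k / a (k + 1) - 1|) := by
    induction n with
    | zero => simp
    | succ n ih =>
      have h1 : a n ≤ a (n + 1) * (1 + |a n / a (n + 1) - 1|) := by
        rw [← div_le_iff₀' (ha _)]
        linarith [le_abs_self (a n / a (n + 1) - 1)]
      refine ih.trans ?_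
      rw [prod_range_succ, mul_comm (∏ k ∈ range n, _), ← mul_assoc]
      exact mul_le_mul_of_nonneg_right h1 (Finset.prod_nonneg fun _ _ => by positivity)
  rw [div_le_iff₀ (Real.exp_pos _)]
  refine hprod.trans (mul_le_mul_of_nonneg_left ?_ (ha n).le)
  exact (Real.prod_one_add_le_exp_sum _ fun k => abs_nonneg _).trans
    (Real.exp_le_exp.2 (hs.sum_le_tsum _ fun k _ => abs_nonneg _))

/-- The transition matrices of a quasi-stationary Markov measure have entries bounded below. -/
theorem exists_pos_le_of_quasiStationary {ι : Type*} [Finite ι] {T : ℕ → Matrix ι ι ℝ}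
    (hpos : ∀ n i j, 0 < T n i j)
    (hqs : ∀ x : ℕ → ι,
      Summable fun n => |T n (x n) (x (n + 1)) / T (n + 1) (x n) (x (n + 1)) - 1|) :
    ∃ c > 0, ∀ n i j, c ≤ T n i j := by
  have hij : ∀ p : ι × ι, ∃ c > 0, ∀ n, c ≤ T n p.1 p.2 := by
    rintro ⟨i, j⟩
    refine exists_pos_le_of_summable_ratio (fun n => hpos n i j) ?_
    refine Summable.of_nonneg_of_le (fun _ => abs_nonneg _) (fun n => ?_)
      ((hqs fun k => if Even k then i else j).add (hqs fun k => if Even k then j else i))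
    by_cases hn : Even n <;> simp [hn, Nat.even_add_one]
  choose c hc hcT using hij
  cases isEmpty_or_nonempty ι
  · exact ⟨1, one_pos, fun _ i => isEmptyElim i⟩
  · obtain ⟨p, hp⟩ := Finite.exists_min c
    exact ⟨c p, hc p, fun n i j => (hp (i, j)).trans (hcT (i, j) n)⟩

end QuasiStationary

section MarkovMeasure

variable {N : ℕ}

/-- The word formed by the letters of index `0, …, n`. -/
def initialWord (n : ℕ) (x : ℕ → Fin N) : Fin (n + 1) → Fin N := fun k => x k

theorem measurable_initialWord (n : ℕ) : Measurable (initialWord (N := N) n) :=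
  measurable_pi_lambda _ fun _ => measurable_pi_apply _

theorem setOf_eq_preimage_initialWord (n : ℕ) (w : Fin (n + 1) → Fin N) :
    {x : ℕ → Fin N | ∀ k ≤ n, x k = w ⟨min k n, by omega⟩} = initialWord n ⁻¹' {w} := by
  ext x
  simp only [Set.mem_ofPred_eq, Set.mem_preimage, Set.mem_singleton_iff, funext_iff, initialWord]
  refine ⟨fun h k => ?_, fun h k hk => ?_⟩
  · simpa [Nat.min_eq_left (Nat.lt_succ_iff.1 k.2)] using h k (Nat.lt_succ_iff.1 k.2)
  · simpa [Nat.min_eq_left hk] using h ⟨k, Nat.lt_succ_iff.2 hk⟩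

variable {l l' : Fin N → ℝ} {T T' : ℕ → Matrix (Fin N) (Fin N) ℝ} {μ μ' : Measure (ℕ → Fin N)}

theorem IsMarkov.real_preimage_singleton (hμ : IsMarkov μ l T) (hl : ∀ i, 0 ≤ l i)
    (hT : ∀ n i j, 0 ≤ T n i j) (n : ℕ) (w : Fin (n + 1) → Fin N) :
    μ.real (initialWord n ⁻¹' {w}) = pathWeight l T n w := by
  have hw : l (w ⟨min 0 n, by omega⟩) * ∏ k ∈ range n,
      T k (w ⟨min k n, by omega⟩) (w ⟨min (k + 1) n, by omega⟩) = pathWeight l T n w := by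
    rw [pathWeight, Finset.prod_range]
    refine congrArg₂ _ (congrArg l (congrArg w (Fin.ext (Nat.zero_min n))))
      (Finset.prod_congr rfl fun k _ => ?_)
    simp only [Nat.min_eq_left k.2.le, Nat.min_eq_left (Nat.succ_le_of_lt k.2)]
    rfl
  rw [measureReal_def, ← setOf_eq_preimage_initialWord, hμ n fun k => w ⟨min k n, by omega⟩, hw,
    ENNReal.toReal_ofReal (pathWeight_nonneg hl hT n w)]

theorem IsMarkov.real_preimage [IsFiniteMeasure μ] (hμ : IsMarkov μ l T) (hl : ∀ i, 0 ≤ l i)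
    (hT : ∀ n i j, 0 ≤ T n i j) (n : ℕ) (A : Finset (Fin (n + 1) → Fin N)) :
    μ.real (initialWord n ⁻¹' A) = ∑ w ∈ A, pathWeight l T n w := by
  rw [← map_measureReal_apply (measurable_initialWord n) A.measurableSet,
    ← sum_measureReal_singleton]
  refine Finset.sum_congr rfl fun w _ => ?_
  rw [map_measureReal_apply (measurable_initialWord n) (measurableSet_singleton w),
    hμ.real_preimage_singleton hl hT]

theorem IsMarkov.le_real_letter [IsFiniteMeasure μ] (hμ : IsMarkov μ l T) (hl : ∀ i, 0 ≤ l i)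
    (hlsum : ∑ i, l i = 1) (hstoch : ∀ n i, ∑ j, T n i j = 1) {c : ℝ} (hc : 0 ≤ c)
    (hT : ∀ n i j, c ≤ T n i j) (n : ℕ) (i : Fin N) : c ≤ μ.real {x | x (n + 1) = i} := by
  have hset : {x : ℕ → Fin N | x (n + 1) = i} = initialWord (n + 1) ⁻¹'
      ((Finset.univ.filter fun w => w (Fin.last (n + 1)) = i :
        Finset (Fin (n + 2) → Fin N)) : Set (Fin (n + 2) → Fin N)) := by
    ext x
    simp [initialWord]
  have h := mul_pathSum_le_pathSum_succ hl hc hT n (f := fun j => if j = i then 1 else 0)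
    fun j => by split_ifs <;> simp
  rw [pathSum_one_of_stochastic hlsum hstoch] at h
  rw [hset, hμ.real_preimage hl fun n i j => hc.trans (hT n i j), Finset.sum_filter]
  simpa [pathSum] using h

/-- If a nonnegative additive functional of a Markov chain with transition probabilities bounded
below is almost surely summable, then it is summable uniformly in the state. -/
theorem IsMarkov.summable_of_ae_summable [IsProbabilityMeasure μ] (hμ : IsMarkov μ l T)
    (hl : ∀ i, 0 ≤ l i) (hlsum : ∑ i, l i = 1) (hstoch : ∀ n i, ∑ j, T n i j = 1) {c : ℝ}
    (hc : 0 < c) (hT : ∀ n i j, c ≤ T n i j) {h : ℕ → Fin N → ℝ} (hh : ∀ n i, 0 ≤ h n i)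
    (hsum : ∀ᵐ x ∂μ, Summable fun n => h n (x n)) : Summable fun n => ∑ i, h n i := by
  set B : ℕ → Set (ℕ → Fin N) := fun M => ⋂ K, {x | ∑ n ∈ range K, h n (x n) ≤ M} with hB
  have hmeas : ∀ n, Measurable fun x : ℕ → Fin N => h n (x n) := fun n =>
    (measurable_of_finite (h n)).comp (measurable_pi_apply n)
  have hBm : ∀ M, MeasurableSet (B M) := fun M => MeasurableSet.iInter fun K =>
    measurableSet_le (Finset.measurable_sum _ fun n _ => hmeas n) measurable_const
  have hmono : Monotone B := fun M M' hM x hx => by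
    simp only [hB, Set.mem_iInter, Set.mem_ofPred_eq] at hx ⊢
    exact fun K => (hx K).trans (by exact_mod_cast hM)
  have hunion : μ (⋃ M, B M) = 1 := by
    rw [prob_compl_eq_zero_iff (MeasurableSet.iUnion hBm) |>.symm]
    refine measure_mono_null (fun x hx => ?_) hsum
    rw [Set.mem_compl_iff] at hx ⊢
    intro hx'
    obtain ⟨M, hM⟩ := exists_nat_ge (∑' n, h n (x n))
    refine hx (Set.mem_iUnion.2 ⟨M, Set.mem_iInter.2 fun K => ?_⟩)
    exact (Summable.sum_le_tsum _ (fun n _ => hh n _) hx').trans hM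
  have hlim : Tendsto (fun M => μ.real (B M)) atTop (𝓝 1) := by
    have := tendsto_measure_iUnion_atTop (μ := μ) hmono
    rw [hunion] at this
    exact (ENNReal.tendsto_toReal ENNReal.one_ne_top).comp this
  obtain ⟨M, hM⟩ := (hlim.eventually (lt_mem_nhds (by linarith : 1 - c / 2 < 1))).exists
  have hinter : ∀ n i, c / 2 ≤ μ.real (B M ∩ {x | x (n + 1) = i}) := by
    intro n i
    have h1 := hμ.le_real_letter hl hlsum hstoch hc.le hT n i
    have h2 := measureReal_union_add_inter (μ := μ) (s := B M) (t := {x | x (n + 1) = i})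
      (measurableSet_eq_fun (measurable_pi_apply _) measurable_const)
    have h3 : μ.real (B M ∪ {x | x (n + 1) = i}) ≤ 1 := measureReal_le_one
    linarith
  have hint : ∀ n, Integrable (fun x : ℕ → Fin N => h n (x n)) (μ.restrict (B M)) := fun n =>
    Integrable.of_bound (hmeas n).aestronglyMeasurable (∑ i, h n i) <| ae_of_all _ fun x => by
      rw [Real.norm_of_nonneg (hh n _)]
      exact Finset.single_le_sum (fun i _ => hh n i) (Finset.mem_univ (x n))
  have hlower : ∀ n, c / 2 * ∑ i, h (n + 1) i ≤ ∫ x in B M, h (n + 1) (x (n + 1)) ∂μ := by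
    intro n
    have hsplit : ∀ x : ℕ → Fin N, h (n + 1) (x (n + 1)) =
        ∑ i, {x : ℕ → Fin N | x (n + 1) = i}.indicator (fun _ => h (n + 1) i) x := fun x => by
      simp [Set.indicator_apply]
    have hms : ∀ i, MeasurableSet {x : ℕ → Fin N | x (n + 1) = i} := fun i =>
      measurableSet_eq_fun (measurable_pi_apply _) measurable_const
    simp_rw [hsplit]
    rw [integral_finsetSum _ fun i _ => (integrable_const _).indicator (hms i), Finset.mul_sum]
    refine Finset.sum_le_sum fun i _ => ?_
    rw [integral_indicator_const _ (hms i), measureReal_restrict_apply (hms i), Set.inter_comm,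
      smul_eq_mul]
    exact mul_le_mul_of_nonneg_right (hinter n i) (hh _ _)
  rw [← summable_nat_add_iff 1]
  refine summable_of_sum_range_le (c := M / (c / 2))
    (fun n => Finset.sum_nonneg fun i _ => hh _ _) fun K => ?_
  rw [le_div_iff₀' (by positivity), Finset.mul_sum]
  calc ∑ n ∈ range K, c / 2 * ∑ i, h (n + 1) i
      ≤ ∑ n ∈ range K, ∫ x in B M, h (n + 1) (x (n + 1)) ∂μ :=
        Finset.sum_le_sum fun n _ => hlower n
    _ = ∫ x in B M, ∑ n ∈ range K, h (n + 1) (x (n + 1)) ∂μ :=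
        (integral_finsetSum _ fun n _ => hint (n + 1)).symm
    _ ≤ ∫ x in B M, (M : ℝ) ∂μ := by
        refine setIntegral_mono_on (integrable_finsetSum _ fun n _ => hint (n + 1))
          (integrable_const _) (hBm M) fun x hx => ?_
        have := Set.mem_iInter.1 hx (K + 1)
        rw [Set.mem_ofPred_eq, Finset.sum_range_succ'] at this
        linarith [hh 0 (x 0)]
    _ ≤ M := by
        rw [setIntegral_const, smul_eq_mul]
        exact mul_le_of_le_one_left (Nat.cast_nonneg M) measureReal_le_one

/-- Absolute continuity of Markov measures with transition probabilities bounded below forces the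
Hellinger distances of the transition probabilities to be summable. -/
theorem IsMarkov.summable_hellinger_of_absolutelyContinuous [IsProbabilityMeasure μ]
    [IsProbabilityMeasure μ'] (hμ : IsMarkov μ l T) (hμ' : IsMarkov μ' l' T')
    (hl : ∀ i, 0 ≤ l i) (hl' : ∀ i, 0 ≤ l' i) (hstoch : ∀ n i, ∑ j, T n i j = 1)
    (hstoch' : ∀ n i, ∑ j, T' n i j = 1) {c c' : ℝ} (hc : 0 < c) (hT : ∀ n i j, c ≤ T n i j)
    (hc' : 0 < c') (hT' : ∀ n i j, c' ≤ T' n i j) (hac : μ ≪ μ') :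
    Summable fun n => ∑ i, (1 - ∑ x, √(T' n i x) * √(T n i x)) := by
  have hT0 : ∀ n i j, 0 ≤ T n i j := fun n i j => hc.le.trans (hT n i j)
  have hT0' : ∀ n i j, 0 ≤ T' n i j := fun n i j => hc'.le.trans (hT' n i j)
  by_contra hdiv
  have hV := tendsto_pathSum_zero (l := fun i => √(l' i) * √(l i))
    (R := fun n i j => √(T' n i j) * √(T n i j)) (c := √c' * √c)
    (fun i => by positivity) (by positivity)
    (fun n i j => mul_le_mul (Real.sqrt_le_sqrt (hT' n i j)) (Real.sqrt_le_sqrt (hT n i j))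
      (Real.sqrt_nonneg _) (Real.sqrt_nonneg _))
    (fun n i => (sub_sub_cancel 1 _).symm)
    (fun n i => hellinger_nonneg (hT0 n i) (hT0' n i) (hstoch n i) (hstoch' n i)) hdiv
  simp only [pathSum, mul_one, pathWeight_sqrt_mul_sqrt hl hT0 hl' hT0'] at hV
  classical
  set A : ∀ n, Finset (Fin (n + 1) → Fin N) := fun n =>
    Finset.univ.filter fun w => pathWeight l' T' n w ≤ pathWeight l T n w with hA
  have hsub : ∀ n (S : Finset (Fin (n + 1) → Fin N)),
      ∑ w ∈ S, √(pathWeight l' T' n w) * √(pathWeight l T n w) ≤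
        ∑ w, √(pathWeight l' T' n w) * √(pathWeight l T n w) := fun n S =>
    Finset.sum_le_sum_of_subset_of_nonneg (Finset.subset_univ S) fun _ _ _ => by positivity
  have hμA' : Tendsto (fun n => μ' (initialWord n ⁻¹' A n)) atTop (𝓝 0) := by
    have : Tendsto (fun n => μ'.real (initialWord n ⁻¹' A n)) atTop (𝓝 0) := by
      refine squeeze_zero (fun n => measureReal_nonneg) (fun n => ?_) hV
      rw [hμ'.real_preimage hl' hT0']
      refine le_trans (Finset.sum_le_sum fun w hw => ?_) (hsub n (A n))
      rw [← Real.mul_self_sqrt (pathWeight_nonneg hl' hT0' n w)]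
      simp only [Real.sqrt_mul_self (Real.sqrt_nonneg _)]
      exact mul_le_mul_of_nonneg_left (Real.sqrt_le_sqrt (Finset.mem_filter.1 hw).2)
        (Real.sqrt_nonneg _)
    simpa [measureReal_def] using ENNReal.tendsto_ofReal this
  have hμA : Tendsto (fun n => μ.real (initialWord n ⁻¹' A n)) atTop (𝓝 0) := by
    have h1 := tendsto_setLIntegral_zero (f := μ.rnDeriv μ')
      (Measure.lintegral_rnDeriv_lt_top μ μ').ne (s := fun n => initialWord n ⁻¹' A n) hμA'
    have := Measure.haveLebesgueDecomposition_of_sigmaFinite μ μ'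
    simp only [Measure.setLIntegral_rnDeriv hac] at h1
    exact (ENNReal.tendsto_toReal ENNReal.zero_ne_top).comp h1
  have hμAc : Tendsto (fun n => μ.real (initialWord n ⁻¹' (A n : Set _))ᶜ) atTop (𝓝 0) := by
    refine squeeze_zero (fun n => measureReal_nonneg) (fun n => ?_) hV
    rw [← Set.preimage_compl, ← Finset.coe_compl, hμ.real_preimage hl hT0]
    refine le_trans (Finset.sum_le_sum fun w hw => ?_) (hsub n (A n)ᶜ)
    have hw' : pathWeight l T n w ≤ pathWeight l' T' n w := by
      simp only [hA, Finset.mem_compl, Finset.mem_filter, Finset.mem_univ, true_and,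
        not_le] at hw
      exact hw.le
    calc pathWeight l T n w = √(pathWeight l T n w) * √(pathWeight l T n w) :=
          (Real.mul_self_sqrt (pathWeight_nonneg hl hT0 n w)).symm
      _ ≤ _ := mul_le_mul_of_nonneg_right (Real.sqrt_le_sqrt hw') (Real.sqrt_nonneg _)
  have hone : ∀ n, μ.real (initialWord n ⁻¹' A n) +
      μ.real (initialWord n ⁻¹' (A n : Set _))ᶜ = 1 := fun n => by
    rw [measureReal_add_measureReal_compl
      (measurable_initialWord n (A n).measurableSet), probReal_univ]
  have hzero := hμA.add hμAc
  simp only [hone, add_zero] at hzero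
  exact one_ne_zero (tendsto_nhds_unique tendsto_const_nhds hzero)

/-- Open sets are increasing unions of sets determined by finitely many letters. -/
theorem exists_monotone_iUnion_preimage_initialWord {U : Set (ℕ → Fin N)} (hU : IsOpen U) :
    ∃ A : ∀ n, Finset (Fin (n + 1) → Fin N),
      Monotone (fun n => initialWord n ⁻¹' (A n : Set (Fin (n + 1) → Fin N))) ∧
        ⋃ n, initialWord n ⁻¹' (A n : Set (Fin (n + 1) → Fin N)) = U := by
  classical
  refine ⟨fun n => Finset.univ.filter fun w => initialWord n ⁻¹' {w} ⊆ U, ?_, ?_⟩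
  · intro n m hnm x hx
    simp only [coe_filter, Finset.mem_univ, true_and, Set.mem_preimage, Set.mem_ofPred_eq] at hx ⊢
    refine fun y hy => hx (funext fun k => ?_)
    exact congrFun hy ⟨k, by omega⟩
  · ext x
    simp only [coe_filter, Finset.mem_univ, true_and, Set.mem_iUnion, Set.mem_preimage,
      Set.mem_ofPred_eq]
    refine ⟨fun ⟨n, hn⟩ => hn rfl, fun hx => ?_⟩
    obtain ⟨I, u, hu, hIu⟩ := isOpen_pi_iff.1 hU x hx
    refine ⟨I.sup id, fun y hy => hIu fun k hk => ?_⟩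
    have hyk : y k = x k := congrFun hy ⟨k, Nat.lt_succ_iff.2 (Finset.le_sup (f := id) hk)⟩
    exact hyk ▸ (hu k hk).2

/-- Summability of the Hellinger distances of the transition probabilities implies absolute
continuity of the Markov measures. -/
theorem IsMarkov.absolutelyContinuous_of_summable_hellinger [IsProbabilityMeasure μ]
    [IsProbabilityMeasure μ'] (hμ : IsMarkov μ l T) (hμ' : IsMarkov μ' l' T')
    (hl : ∀ i, 0 ≤ l i) (hl' : ∀ i, 0 < l' i) (hT : ∀ n i j, 0 ≤ T n i j)
    (hstoch : ∀ n i, ∑ j, T n i j = 1) (hstoch' : ∀ n i, ∑ j, T' n i j = 1) {c' : ℝ}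
    (hc' : 0 < c') (hT' : ∀ n i j, c' ≤ T' n i j)
    (hsum : Summable fun n => ∑ i, (1 - ∑ x, √(T' n i x) * √(T n i x))) : μ ≪ μ' := by
  have hT0' : ∀ n i j, 0 < T' n i j := fun n i j => hc'.trans_le (hT' n i j)
  have hh : ∀ n i, 0 ≤ 1 - ∑ x, √(T' n i x) * √(T n i x) := fun n i =>
    hellinger_nonneg (hT n i) (fun j => (hT0' n i j).le) (hstoch n i) (hstoch' n i)
  obtain ⟨b, hb⟩ : ∃ b : ℝ, ∀ n,
      ∑ w, pathWeight l T n w ^ 2 / pathWeight l' T' n w ≤ b := by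
    refine ⟨(∑ i, l i ^ 2 / l' i) *
      Real.exp (∑' n, 8 / c' * ∑ i, (1 - ∑ x, √(T' n i x) * √(T n i x))), fun n => ?_⟩
    have := pathSum_le_exp (l := fun i => l i ^ 2 / l' i)
      (R := fun n i j => T n i j ^ 2 / T' n i j)
      (H := fun n => 8 / c' * ∑ i, (1 - ∑ x, √(T' n i x) * √(T n i x)))
      (fun i => div_nonneg (sq_nonneg _) (hl' i).le)
      (fun n i j => div_nonneg (sq_nonneg _) (hT0' n i j).le)
      (fun n i => (sum_sq_div_le hc' (hT n i) (hT' n i) (hstoch n i) (hstoch' n i)).trans <| by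
        gcongr
        exact Finset.single_le_sum (fun i _ => hh n i) (Finset.mem_univ i))
      (fun n => mul_nonneg (by positivity) (Finset.sum_nonneg fun i _ => hh n i))
      (hsum.mul_left _) n
    simpa only [pathSum, mul_one, pathWeight_sq_div] using this
  have hfin : ∀ t : ℝ, 0 < t → ∀ n (A : Finset (Fin (n + 1) → Fin N)),
      μ.real (initialWord n ⁻¹' A) ≤ t * μ'.real (initialWord n ⁻¹' A) + b / t := by
    intro t ht n A
    have hp' : ∀ w, 0 < pathWeight l' T' n w := pathWeight_pos hl' hT0' n
    rw [hμ.real_preimage hl hT, hμ'.real_preimage (fun i => (hl' i).le)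
      fun n i j => (hT0' n i j).le]
    have hterm : ∀ w, pathWeight l T n w ≤ t * pathWeight l' T' n w +
        pathWeight l T n w ^ 2 / pathWeight l' T' n w / t := fun w => by
      have hq := hp' w
      rw [div_div, ← sub_nonneg]
      have : t * pathWeight l' T' n w + pathWeight l T n w ^ 2 / (pathWeight l' T' n w * t) -
          pathWeight l T n w = ((t * pathWeight l' T' n w - pathWeight l T n w / 2) ^ 2 +
            3 / 4 * pathWeight l T n w ^ 2) / (pathWeight l' T' n w * t) := by
        field_simp
        ring
      rw [this]
      positivity
    refine (Finset.sum_le_sum fun w _ => hterm w).trans ?_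
    rw [Finset.sum_add_distrib, ← Finset.mul_sum, ← Finset.sum_div]
    gcongr
    refine le_trans ?_ (hb n)
    exact Finset.sum_le_sum_of_subset_of_nonneg (Finset.subset_univ A) fun w _ _ =>
      div_nonneg (sq_nonneg _) (hp' w).le
  have hopen : ∀ t : ℝ, 0 < t → ∀ U : Set (ℕ → Fin N), IsOpen U →
      μ.real U ≤ t * μ'.real U + b / t := by
    intro t ht U hU
    obtain ⟨A, hmono, rfl⟩ := exists_monotone_iUnion_preimage_initialWord hU
    have hlim : ∀ ν : Measure (ℕ → Fin N), IsProbabilityMeasure ν →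
        Tendsto (fun n => ν.real (initialWord n ⁻¹' (A n : Set _))) atTop
          (𝓝 (ν.real (⋃ n, initialWord n ⁻¹' (A n : Set _)))) := fun ν _ =>
      (ENNReal.tendsto_toReal (measure_ne_top ν _)).comp (tendsto_measure_iUnion_atTop hmono)
    exact le_of_tendsto_of_tendsto' (hlim μ inferInstance)
      (((hlim μ' inferInstance).const_mul t).add_const _) fun n => hfin t ht n (A n)
  intro s hs
  have hbound : ∀ t : ℝ, 0 < t → μ.real s ≤ (1 + b) / t := by
    intro t ht
    obtain ⟨U, hsU, hU, hμU⟩ := Set.exists_isOpen_lt_of_lt (μ := μ') s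
      (ENNReal.ofReal (1 / t ^ 2)) (by rw [hs, ENNReal.ofReal_pos]; positivity)
    have hμU' : μ'.real U ≤ 1 / t ^ 2 :=
      ENNReal.toReal_le_of_le_ofReal (by positivity) hμU.le
    calc μ.real s ≤ μ.real U := measureReal_mono hsU
      _ ≤ t * μ'.real U + b / t := hopen t ht U hU
      _ ≤ t * (1 / t ^ 2) + b / t := by gcongr
      _ = (1 + b) / t := by field_simp
  have hzero : μ.real s ≤ 0 :=
    ge_of_tendsto (tendsto_id.const_div_atTop (1 + b)) <|
      (eventually_gt_atTop 0).mono fun t ht => hbound t ht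
  exact (measureReal_eq_zero_iff).1 (le_antisymm hzero measureReal_nonneg)

end MarkovMeasure

/-- Two quasi-stationary Markov measures `μ, μ'` are equivalent if and only if
for `μ`-a.e. and `μ'`-a.e. word `i₁i₂…`,
`Σ_{n=1}^∞ (1 − Σ_{x ∈ Z_N} √(T'^(n)_{i_n,x}) √(T^(n)_{i_n,x})) < ∞`. -/
theorem markov_equivalent_iff_hellinger (N : ℕ) (hN : 2 ≤ N)
    (l l' : Fin N → ℝ) (T T' : ℕ → Matrix (Fin N) (Fin N) ℝ)
    (hl : ∀ i, 0 < l i) (hlsum : ∑ i, l i = 1)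
    (hpos : ∀ n i j, 0 < T n i j) (hstoch : ∀ n i, ∑ j, T n i j = 1)
    (hfix : ∀ j, ∑ i, l i * T 0 i j = l j)
    (hl' : ∀ i, 0 < l' i) (hlsum' : ∑ i, l' i = 1)
    (hpos' : ∀ n i j, 0 < T' n i j) (hstoch' : ∀ n i, ∑ j, T' n i j = 1)
    (hfix' : ∀ j, ∑ i, l' i * T' 0 i j = l' j)
    (μ μ' : Measure (ℕ → Fin N)) [IsProbabilityMeasure μ] [IsProbabilityMeasure μ']
    (hμ : IsMarkov μ l T) (hμ' : IsMarkov μ' l' T')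
    (hqs : ∀ x : ℕ → Fin N,
      Summable fun n => |T n (x n) (x (n + 1)) / T (n + 1) (x n) (x (n + 1)) - 1|)
    (hqs' : ∀ x : ℕ → Fin N,
      Summable fun n => |T' n (x n) (x (n + 1)) / T' (n + 1) (x n) (x (n + 1)) - 1|)
    :
    (μ ≪ μ' ∧ μ' ≪ μ) ↔
      ((∀ᵐ i ∂μ, Summable fun n =>
          1 - ∑ x : Fin N, Real.sqrt (T' n (i n) x) * Real.sqrt (T n (i n) x)) ∧
        (∀ᵐ i ∂μ', Summable fun n =>
          1 - ∑ x : Fin N, Real.sqrt (T' n (i n) x) * Real.sqrt (T n (i n) x))) := by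

  obtain ⟨c, hc, hT⟩ := exists_pos_le_of_quasiStationary hpos hqs
  obtain ⟨c', hc', hT'⟩ := exists_pos_le_of_quasiStationary hpos' hqs'
  have hl0 := fun i => (hl i).le
  have hh : ∀ n i, 0 ≤ 1 - ∑ x, √(T' n i x) * √(T n i x) := fun n i =>
    hellinger_nonneg (fun j => (hpos n i j).le) (fun j => (hpos' n i j).le)
      (hstoch n i) (hstoch' n i)
  constructor
  · rintro ⟨hac, -⟩
    have hD := hμ.summable_hellinger_of_absolutelyContinuous hμ' hl0 (fun i => (hl' i).le)
      hstoch hstoch' hc hT hc' hT' hac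
    have hall : ∀ i : ℕ → Fin N,
        Summable fun n => 1 - ∑ x : Fin N, √(T' n (i n) x) * √(T n (i n) x) := fun i =>
      Summable.of_nonneg_of_le (fun n => hh n (i n))
        (fun n => Finset.single_le_sum (fun i _ => hh n i) (Finset.mem_univ (i n))) hD
    exact ⟨ae_of_all _ hall, ae_of_all _ hall⟩
  · rintro ⟨hae, -⟩
    have hD := hμ.summable_of_ae_summable hl0 hlsum hstoch hc hT hh hae
    refine ⟨hμ.absolutelyContinuous_of_summable_hellinger hμ' hl0 hl'
      (fun n i j => (hpos n i j).le) hstoch hstoch' hc' hT' hD, ?_⟩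
    refine hμ'.absolutelyContinuous_of_summable_hellinger hμ (fun i => (hl' i).le) hl
      (fun n i j => (hpos' n i j).le) hstoch' hstoch hc hT ?_
    simpa only [mul_comm] using hD
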